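/- arXiv:0910.2933 — 2 statements merged into one kernel-verified Lean document; each statement's English description precedes it below -/
import Mathlib

section
/- Let g be the solvable Lie algebra of real 3×3 matrices A with A = [[0,a1,a2],[0,a3,a4],[0,0,0]]. For λ ∈ ℝ and μ ≠ 0, the symmetric bilinear form M(A,B) = λ a3 b3 + μ(a2 b3 + a3 b2 − a1 b4 − a4 b1) is nondegenerate and bi-invariant: M([C,A],B) + M(A,[C,B]) = 0 for all A,B,C ∈ g. -/
/-- The solvable Lie algebra of real 3×3 matrices of the form
`[[0,a1,a2],[0,a3,a4],[0,0,0]]`, as a subset of the 3×3 matrices. -/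
def lieG : Set (Matrix (Fin 3) (Fin 3) ℝ) :=
  {A | A 0 0 = 0 ∧ A 1 0 = 0 ∧ A 2 0 = 0 ∧ A 2 1 = 0 ∧ A 2 2 = 0}

/-- The bilinear form `M(A,B) = λ a3 b3 + μ(a2 b3 + a3 b2 − a1 b4 − a4 b1)`, where
`a1 = A 0 1`, `a2 = A 0 2`, `a3 = A 1 1`, `a4 = A 1 2` and similarly for `B`. -/
def lieGForm (l μ : ℝ) (A B : Matrix (Fin 3) (Fin 3) ℝ) : ℝ :=
  l * A 1 1 * B 1 1 + μ * (A 0 2 * B 1 1 + A 1 1 * B 0 2 - A 0 1 * B 1 2 - A 1 2 * B 0 1)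

/-- On the solvable Lie algebra `lieG` (with the matrix commutator), the
symmetric bilinear form `lieGForm l μ` (with `μ ≠ 0`) is nondegenerate and bi-invariant:
`M([C,A],B) + M(A,[C,B]) = 0` for all `A,B,C ∈ g`. -/
theorem stmt_6 (l μ : ℝ) (hμ : μ ≠ 0) :
    (∀ A B, lieGForm l μ A B = lieGForm l μ B A) ∧
    (∀ A B C : Matrix (Fin 3) (Fin 3) ℝ, A ∈ lieG → B ∈ lieG → C ∈ lieG →
      lieGForm l μ (C * A - A * C) B + lieGForm l μ A (C * B - B * C) = 0) ∧
    (∀ A ∈ lieG, (∀ B ∈ lieG, lieGForm l μ A B = 0) → A = 0) := by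
  refine ⟨fun A B => by unfold lieGForm; ring, ?_, ?_⟩
  · rintro A B C ⟨a1, a2, a3, a4, a5⟩ ⟨b1, b2, b3, b4, b5⟩ ⟨c1, c2, c3, c4, c5⟩
    simp only [lieGForm, Matrix.sub_apply, Matrix.mul_apply, Fin.sum_univ_three,
      a1, a2, a3, a4, a5, b1, b2, b3, b4, b5, c1, c2, c3, c4, c5]
    ring
  · rintro A ⟨a1, a2, a3, a4, a5⟩ h
    have h1 := h !![0, 1, 0; 0, 0, 0; 0, 0, 0] (by simp [lieG])
    have h2 := h !![0, 0, 1; 0, 0, 0; 0, 0, 0] (by simp [lieG])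
    have h3 := h !![0, 0, 0; 0, 1, 0; 0, 0, 0] (by simp [lieG])
    have h4 := h !![0, 0, 0; 0, 0, 1; 0, 0, 0] (by simp [lieG])
    simp [lieGForm, hμ] at h1 h2 h3 h4
    simp [h2, hμ] at h3
    ext i j
    fin_cases i <;> fin_cases j <;> simp [*]
end

section
/- For the system u_{xy} = λ(x,y)u, v_{xy} = λ(x,y)v, the three Lagrangians L1 = u_x u_y + λu², L2 = u_x v_y + λuv, L3 = v_x v_y + λv² satisfy: E_1(L1) = −2(u_{xy} − λu), E_2(L1) = 0; E_1(L2) = −(v_{xy} − λv), E_2(L2) = −(u_{xy} − λu); E_1(L3) = 0, E_2(L3) = −2(v_{xy} − λv). In particular, the system admits three linearly independent variational multipliers. -/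
/-- `x`-partial derivative of `f : ℝ × ℝ → ℝ` (curried). -/
noncomputable def px (f : ℝ → ℝ → ℝ) (x y : ℝ) : ℝ := deriv (fun s => f s y) x

/-- `y`-partial derivative of `f : ℝ × ℝ → ℝ` (curried). -/
noncomputable def py (f : ℝ → ℝ → ℝ) (x y : ℝ) : ℝ := deriv (fun t => f x t) y

/-- Mixed second partial `f_xy`. -/
noncomputable def pxy (f : ℝ → ℝ → ℝ) (x y : ℝ) : ℝ := deriv (fun t => px f x t) y

/-- The Euler-Lagrange expression `E_1(L) = ∂L/∂u − D_x(∂L/∂u_x) − D_y(∂L/∂u_y)` of a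
first-order Lagrangian `L(x, y, u, v, u_x, v_x, u_y, v_y)` along a section `(u,v)`. -/
noncomputable def EL1 (L : ℝ → ℝ → ℝ → ℝ → ℝ → ℝ → ℝ → ℝ → ℝ) (u v : ℝ → ℝ → ℝ)
    (x y : ℝ) : ℝ :=
  deriv (fun w => L x y w (v x y) (px u x y) (px v x y) (py u x y) (py v x y)) (u x y)
    - deriv (fun s =>
        deriv (fun w => L s y (u s y) (v s y) w (px v s y) (py u s y) (py v s y)) (px u s y)) x
    - deriv (fun t =>
        deriv (fun w => L x t (u x t) (v x t) (px u x t) (px v x t) w (py v x t)) (py u x t)) y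

/-- The Euler-Lagrange expression `E_2(L) = ∂L/∂v − D_x(∂L/∂v_x) − D_y(∂L/∂v_y)`. -/
noncomputable def EL2 (L : ℝ → ℝ → ℝ → ℝ → ℝ → ℝ → ℝ → ℝ → ℝ) (u v : ℝ → ℝ → ℝ)
    (x y : ℝ) : ℝ :=
  deriv (fun w => L x y (u x y) w (px u x y) (px v x y) (py u x y) (py v x y)) (v x y)
    - deriv (fun s =>
        deriv (fun w => L s y (u s y) (v s y) (px u s y) w (py u s y) (py v s y)) (px v s y)) x
    - deriv (fun t =>
        deriv (fun w => L x t (u x t) (v x t) (px u x t) (px v x t) (py u x t) w) (py v x t)) y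

theorem aux_x (G : ℝ × ℝ → ℝ) (hG : Differentiable ℝ G) (a b : ℝ) :
    deriv (fun s => G (s, b)) a = fderiv ℝ G (a, b) (1, 0) := by
  have c : HasDerivAt (fun s : ℝ => (s, b)) ((1 : ℝ), (0 : ℝ)) a :=
    (hasDerivAt_id a).prodMk (hasDerivAt_const a b)
  have h : HasFDerivAt G (fderiv ℝ G (a, b)) (a, b) := (hG (a, b)).hasFDerivAt
  have := HasFDerivAt.comp_hasDerivAt_of_eq a h c rfl
  exact this.deriv

theorem aux_y (G : ℝ × ℝ → ℝ) (hG : Differentiable ℝ G) (a b : ℝ) :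
    deriv (fun s => G (a, s)) b = fderiv ℝ G (a, b) (0, 1) := by
  have c : HasDerivAt (fun s : ℝ => (a, s)) ((0 : ℝ), (1 : ℝ)) b :=
    (hasDerivAt_const b a).prodMk (hasDerivAt_id b)
  have h : HasFDerivAt G (fderiv ℝ G (a, b)) (a, b) := (hG (a, b)).hasFDerivAt
  have := HasFDerivAt.comp_hasDerivAt_of_eq b h c rfl
  exact this.deriv

theorem aux_app (F : ℝ × ℝ → ℝ) (hd2 : Differentiable ℝ (fderiv ℝ F)) (z e d : ℝ × ℝ) :
    fderiv ℝ (fun w => fderiv ℝ F w e) z d = fderiv ℝ (fderiv ℝ F) z d e := by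
  rw [fderiv_clm_apply (hd2 z) (differentiableAt_const e)]
  simp

theorem aux_symm (u : ℝ → ℝ → ℝ)
    (hu : ContDiff ℝ (⊤ : ℕ∞) fun z : ℝ × ℝ => u z.1 z.2) (x y : ℝ) :
    deriv (fun s => py u s y) x = pxy u x y := by
  obtain ⟨F, hF⟩ : ∃ F : ℝ × ℝ → ℝ, F = fun z => u z.1 z.2 := ⟨_, rfl⟩
  rw [← hF] at hu
  have hd : Differentiable ℝ F := hu.differentiable (by simp)
  have hu2 : ContDiff ℝ 2 F := hu.of_le (WithTop.coe_le_coe.2 (le_top : (2 : ℕ∞) ≤ ⊤))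
  have hd2 : Differentiable ℝ (fderiv ℝ F) :=
    (hu2.fderiv_right (m := 1) (by norm_num)).differentiable (by simp)
  have hpx : ∀ a b, px u a b = fderiv ℝ F (a, b) (1, 0) := fun a b => by
    rw [← aux_x F hd, hF]; rfl
  have hpy : ∀ a b, py u a b = fderiv ℝ F (a, b) (0, 1) := fun a b => by
    rw [← aux_y F hd, hF]; rfl
  have hc : ∀ e : ℝ × ℝ, Differentiable ℝ (fun w => fderiv ℝ F w e) := fun e =>
    hd2.clm_apply (differentiable_const e)
  unfold pxy
  simp only [hpx, hpy]
  rw [aux_x (fun w => fderiv ℝ F w (0, 1)) (hc _), aux_y (fun w => fderiv ℝ F w (1, 0)) (hc _),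
    aux_app F hd2, aux_app F hd2]
  exact second_derivative_symmetric (fun z => (hd z).hasFDerivAt) (hd2 (x, y)).hasFDerivAt _ _

theorem aux_lin (a b c : ℝ) : deriv (fun w : ℝ => w * a + b) c = a := by
  simp

theorem aux_lin2 (a b c : ℝ) : deriv (fun w : ℝ => a * w + b) c = a := by
  simp

theorem aux_sq (a b c : ℝ) : deriv (fun w : ℝ => b + a * w ^ 2) c = 2 * a * c := by
  simp; ring

theorem aux_l3 (a b d c : ℝ) : deriv (fun w : ℝ => b + a * w * d) c = a * d := by
  simp

theorem aux_l4 (a b c : ℝ) : deriv (fun w : ℝ => b + a * w) c = a := by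
  simp

/-- For the system `u_xy = λ(x,y)u`, `v_xy = λ(x,y)v`, the Lagrangians
`L1 = u_x u_y + λu²`, `L2 = u_x v_y + λuv`, `L3 = v_x v_y + λv²` satisfy
`E_1(L1) = −2(u_xy − λu)`, `E_2(L1) = 0`; `E_1(L2) = −(v_xy − λv)`,
`E_2(L2) = −(u_xy − λu)`; `E_1(L3) = 0`, `E_2(L3) = −2(v_xy − λv)`; in particular the
three corresponding variational multipliers are linearly independent. -/
theorem stmt_19 (lam u v : ℝ → ℝ → ℝ)
    (hlam : ContDiff ℝ (⊤ : ℕ∞) fun z : ℝ × ℝ => lam z.1 z.2)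
    (hu : ContDiff ℝ (⊤ : ℕ∞) fun z : ℝ × ℝ => u z.1 z.2)
    (hv : ContDiff ℝ (⊤ : ℕ∞) fun z : ℝ × ℝ => v z.1 z.2)
    (L1 L2 L3 : ℝ → ℝ → ℝ → ℝ → ℝ → ℝ → ℝ → ℝ → ℝ)
    (hL1 : L1 = fun x y U V UX VX UY VY => UX * UY + lam x y * U ^ 2)
    (hL2 : L2 = fun x y U V UX VX UY VY => UX * VY + lam x y * U * V)
    (hL3 : L3 = fun x y U V UX VX UY VY => VX * VY + lam x y * V ^ 2) :
    (∀ x y, EL1 L1 u v x y = -2 * (pxy u x y - lam x y * u x y)) ∧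
    (∀ x y, EL2 L1 u v x y = 0) ∧
    (∀ x y, EL1 L2 u v x y = -(pxy v x y - lam x y * v x y)) ∧
    (∀ x y, EL2 L2 u v x y = -(pxy u x y - lam x y * u x y)) ∧
    (∀ x y, EL1 L3 u v x y = 0) ∧
    (∀ x y, EL2 L3 u v x y = -2 * (pxy v x y - lam x y * v x y)) ∧
    LinearIndependent ℝ
      ![(!![-2, 0; 0, 0] : Matrix (Fin 2) (Fin 2) ℝ), !![0, -1; -1, 0], !![0, 0; 0, -2]] := by
  have su := aux_symm u hu
  have sv := aux_symm v hv
  have eu : ∀ x y, deriv (fun t => px u x t) y = pxy u x y := fun _ _ => rfl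
  have ev : ∀ x y, deriv (fun t => px v x t) y = pxy v x y := fun _ _ => rfl
  subst hL1 hL2 hL3
  refine ⟨?_, ?_, ?_, ?_, ?_, ?_, ?_⟩
  iterate 6
    · intro x y
      simp only [EL1, EL2, aux_lin, aux_lin2, aux_sq, aux_l3, aux_l4, deriv_const, su, sv, eu, ev]
      try ring
  rw [Fintype.linearIndependent_iff]
  intro g hg
  have h00 := congrFun (congrFun hg 0) 0
  have h01 := congrFun (congrFun hg 0) 1
  have h11 := congrFun (congrFun hg 1) 1
  simp [Fin.sum_univ_three] at h00 h01 h11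
  intro i
  fin_cases i <;> simp [h00, h01, h11]
end
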